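/- arXiv:1107.3177 — 2 statements merged into one kernel-verified Lean document; each statement's English description precedes it below -/
import Mathlib

section
/- Let {μ^{(ℓ)}} be the WMS iterates with parameter β = 1/(d_v−1) and suppose {μ^{(ℓ)}} is divergent and consistent. Then there exist δ ∈ [0,1) and an integer L_0 > 0 such that the WMS iterates with parameter β_δ = δ/(d_v−1) converge to a WMS-consistent fixed point μ_δ* of W_{β_δ}, the hard decision vector x_δ* of μ_δ* (with parameter β_δ) equals the hard decision vector x^{(L_0)} of μ^{(L_0)} (with parameter 1/(d_v−1)), and this common vector is a codeword satisfying Σ_{i∈V_L} γ_i x_{δ,i}* ≤ Σ_{i∈V_L} γ_i x_i for every codeword x (i.e., it is a maximum-likelihood codeword). -/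
open Finset Filter

/-- Check-to-bit message computed from a WMS message vector `μ`:
`μ_{i←k} = (Π_{m∈N(k)\{i}} sgn(μ_{m→k})) · min_{m∈N(k)\{i}} |μ_{m→k}|`. -/
noncomputable def c2b {VL VR : Type*} [DecidableEq VL]
    (Nc : VR → Finset VL) (μ : VL → VR → ℝ) (i : VL) (k : VR) : ℝ :=
  (∏ m ∈ (Nc k).erase i, Real.sign (μ m k)) *
    ⨅ m : {m : VL // m ∈ (Nc k).erase i}, |μ m.1 k|

/-- The weighted min-sum operator `W_β`:
`(W_β[μ])_{i→j} = γ_i + β·Σ_{k∈N(i)\{j}} μ_{i←k}`. -/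
noncomputable def Wop {VL VR : Type*} [DecidableEq VL] [DecidableEq VR]
    (Nv : VL → Finset VR) (Nc : VR → Finset VL) (γ : VL → ℝ) (β : ℝ)
    (μ : VL → VR → ℝ) : VL → VR → ℝ :=
  fun i j => γ i + β * ∑ k ∈ (Nv i).erase j, c2b Nc μ i k

/-- The WMS iterates, initialized with the channel LLRs: `μ^{(0)}_{i→j} = γ_i`,
`μ^{(ℓ+1)} = W_β[μ^{(ℓ)}]`. -/
noncomputable def wmsIter {VL VR : Type*} [DecidableEq VL] [DecidableEq VR]
    (Nv : VL → Finset VR) (Nc : VR → Finset VL) (γ : VL → ℝ) (β : ℝ) :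
    ℕ → VL → VR → ℝ :=
  fun n => (Wop Nv Nc γ β)^[n] (fun i _ => γ i)

/-- WMS-consistency of a message vector (with parameter `β`). -/
def WMSConsistent {VL VR : Type*} [DecidableEq VL] [DecidableEq VR]
    (Nv : VL → Finset VR) (Nc : VR → Finset VL) (γ : VL → ℝ) (β : ℝ)
    (μ : VL → VR → ℝ) : Prop :=
  (∀ i : VL, ∀ j ∈ Nv i, μ i j ≠ 0) ∧
  (∀ i : VL, ∀ j ∈ Nv i, ∀ j' ∈ Nv i, Real.sign (μ i j) = Real.sign (μ i j')) ∧
  (∀ i : VL, ∀ j ∈ Nv i, Real.sign (c2b Nc μ i j) = Real.sign (μ i j)) ∧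
  (∀ i : VL, ∀ j' ∈ Nv i,
    Real.sign (γ i + β * ∑ j ∈ Nv i, c2b Nc μ i j) = Real.sign (μ i j'))

/-- Hard decisions computed from a WMS message vector:
`x̂_i = (1 − sgn(γ_i + β·Σ_{j∈N(i)} μ_{i←j}))/2`. -/
noncomputable def hardDec {VL VR : Type*} [DecidableEq VL]
    (Nv : VL → Finset VR) (Nc : VR → Finset VL) (γ : VL → ℝ) (β : ℝ)
    (μ : VL → VR → ℝ) : VL → ℝ :=
  fun i => (1 - Real.sign (γ i + β * ∑ j ∈ Nv i, c2b Nc μ i j)) / 2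

/-- Sup-norm over edges of an edge-indexed family of reals. -/
noncomputable def edgeSup {VL VR : Type*} (Nv : VL → Finset VR) (f : VL → VR → ℝ) : ℝ :=
  ⨆ p : {q : VL × VR // q.2 ∈ Nv q.1}, |f p.1.1 p.1.2|

/-- Sup-norm `‖γ‖_∞` of the LLR vector. -/
noncomputable def gammaSup {VL : Type*} (γ : VL → ℝ) : ℝ := ⨆ i, |γ i|

/-- A codeword, as a real vector with entries in `{0, 1}` whose sum over each check
neighborhood is even. -/
def IsCodewordR {VL VR : Type*} (Nc : VR → Finset VL) (x : VL → ℝ) : Prop :=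
  (∀ i, x i = 0 ∨ x i = 1) ∧ ∀ j : VR, ∃ m : ℤ, ∑ i ∈ Nc j, x i = 2 * m

/-- The WMS iterates with parameter `1/(d_v−1)` are divergent and consistent: every edge
message tends to `+∞` or `−∞`, and from some iteration on the messages are WMS-consistent. -/
def DivergentConsistent {VL VR : Type*} [DecidableEq VL] [DecidableEq VR]
    (Nv : VL → Finset VR) (Nc : VR → Finset VL) (γ : VL → ℝ) (dv : ℕ)
    (μseq : ℕ → VL → VR → ℝ) : Prop :=
  (∀ i : VL, ∀ j ∈ Nv i,
    Tendsto (fun ℓ => μseq ℓ i j) atTop atTop ∨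
    Tendsto (fun ℓ => μseq ℓ i j) atTop atBot) ∧
  (∃ L : ℕ, 0 < L ∧ ∀ ℓ : ℕ, L ≤ ℓ → WMSConsistent Nv Nc γ (1 / ((dv : ℝ) - 1)) (μseq ℓ))

/-- The smallest value of `ν · k` over the neighbors of `k` other than `i`. -/
noncomputable def minOther {VL VR : Type*} [DecidableEq VL]
    (Nc : VR → Finset VL) (ν : VL → VR → ℝ) (i : VL) (k : VR) : ℝ :=
  ⨅ m : {m : VL // m ∈ (Nc k).erase i}, ν m.1 k

/-- The min-sum operator without signs, set to zero off the edges. It is monotone on all of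
`VL → VR → ℝ`, and conjugate to `Wop` on message vectors whose signs form a codeword. -/
noncomputable def minSumOp {VL VR : Type*} [DecidableEq VL] [DecidableEq VR]
    (Nv : VL → Finset VR) (Nc : VR → Finset VL) (σ : VL → ℝ) (β : ℝ)
    (ν : VL → VR → ℝ) : VL → VR → ℝ :=
  fun i j => if j ∈ Nv i then σ i + β * ∑ k ∈ (Nv i).erase j, minOther Nc ν i k else 0

section SumLemmas

variable {α : Type*}

lemma sum_sum_erase [DecidableEq α] (S : Finset α) (f : α → ℝ) :
    ∑ j ∈ S, ∑ k ∈ S.erase j, f k = ((S.card : ℝ) - 1) * ∑ k ∈ S, f k := by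
  have h : ∀ j ∈ S, ∑ k ∈ S.erase j, f k = ∑ k ∈ S, f k - f j := fun j hj =>
    Finset.sum_erase_eq_sub hj
  rw [Finset.sum_congr rfl h, Finset.sum_sub_distrib, Finset.sum_const, nsmul_eq_mul]
  ring

lemma sum_le_sum_of_le_of_ne [DecidableEq α] (S : Finset α) (hS : S.card ≠ 1) (f g : α → ℝ)
    (h : ∀ i ∈ S, ∀ j ∈ S, j ≠ i → f i ≤ g j) : ∑ i ∈ S, f i ≤ ∑ i ∈ S, g i := by
  rcases S.eq_empty_or_nonempty with rfl | hne
  · simp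
  have hpos : 0 < S.card := hne.card_pos
  have h2 : (0 : ℝ) < (S.card : ℝ) - 1 := by
    have : (1 : ℝ) < S.card := by exact_mod_cast (by omega : 1 < S.card)
    linarith
  refine le_of_mul_le_mul_left ?_ h2
  rw [← sum_sum_erase S g, Finset.mul_sum]
  refine Finset.sum_le_sum fun i hi => ?_
  have := Finset.card_nsmul_le_sum (S.erase i) g (f i) fun j hj =>
    h i hi j (Finset.mem_of_mem_erase hj) (Finset.ne_of_mem_erase hj)
  rwa [Finset.card_erase_of_mem hi, nsmul_eq_mul, Nat.cast_pred hpos] at this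

lemma abs_affine_sum_sub_le (S : Finset α) (f g : α → ℝ) (c β D : ℝ) (hβ : 0 ≤ β)
    (h : ∀ k ∈ S, |f k - g k| ≤ D) :
    |(c + β * ∑ k ∈ S, f k) - (c + β * ∑ k ∈ S, g k)| ≤ β * (S.card * D) := by
  rw [add_sub_add_left_eq_sub, ← mul_sub, ← Finset.sum_sub_distrib, abs_mul, abs_of_nonneg hβ]
  refine mul_le_mul_of_nonneg_left ((Finset.abs_sum_le_sum_abs _ _).trans ?_) hβ
  simpa [nsmul_eq_mul] using Finset.sum_le_card_nsmul S _ D h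

lemma prod_eq_one_or_neg_one (S : Finset α) (s : α → ℝ) (hs : ∀ i, s i = 1 ∨ s i = -1) :
    ∏ i ∈ S, s i = 1 ∨ ∏ i ∈ S, s i = -1 := by
  classical
  induction S using Finset.induction_on with
  | empty => simp
  | insert a S ha ih =>
    rw [Finset.prod_insert ha]
    rcases hs a with h | h <;> rcases ih with h' | h' <;> simp [h, h']

lemma exists_two_mul_of_prod_eq_one (S : Finset α) (s : α → ℝ)
    (hs : ∀ i, s i = 1 ∨ s i = -1) (h : ∏ i ∈ S, s i = 1) :
    ∃ m : ℤ, ∑ i ∈ S, (1 - s i) / 2 = 2 * m := by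
  classical
  suffices H : ∃ m : ℤ, ∑ i ∈ S, (1 - s i) / 2 = 2 * m + (1 - ∏ i ∈ S, s i) / 2 by
    simpa [h] using H
  clear h
  induction S using Finset.induction_on with
  | empty => exact ⟨0, by simp⟩
  | insert a S ha ih =>
    obtain ⟨m, hm⟩ := ih
    rw [Finset.sum_insert ha, Finset.prod_insert ha, hm]
    rcases hs a with h | h <;> rcases prod_eq_one_or_neg_one S s hs with h' | h'
    · exact ⟨m, by rw [h, h']; ring⟩
    · exact ⟨m, by rw [h, h']; ring⟩
    · exact ⟨m, by rw [h, h']; ring⟩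
    · exact ⟨m + 1, by rw [h, h']; push_cast; ring⟩

lemma abs_prod_sign_le_one (S : Finset α) (f : α → ℝ) :
    |∏ m ∈ S, Real.sign (f m)| ≤ 1 := by
  rw [Finset.abs_prod]
  refine Finset.prod_le_one (fun _ _ => abs_nonneg _) fun m _ => ?_
  rcases Real.sign_apply_eq (f m) with h | h | h <;> simp [h]

end SumLemmas

section MinOther

variable {VL VR : Type*} [DecidableEq VL] {Nc : VR → Finset VL}

lemma minOther_le (ν : VL → VR → ℝ) {i m : VL} {k : VR} (hm : m ∈ (Nc k).erase i) :
    minOther Nc ν i k ≤ ν m k :=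
  ciInf_le (f := fun m : {m : VL // m ∈ (Nc k).erase i} => ν m.1 k)
    (Set.finite_range _).bddBelow ⟨m, hm⟩

lemma exists_minOther_eq (ν : VL → VR → ℝ) {i : VL} {k : VR}
    (hne : ((Nc k).erase i).Nonempty) :
    ∃ m ∈ (Nc k).erase i, minOther Nc ν i k = ν m k := by
  have : Nonempty {m : VL // m ∈ (Nc k).erase i} := hne.to_subtype
  obtain ⟨m, hm⟩ := exists_eq_ciInf_of_finite
    (f := fun m : {m : VL // m ∈ (Nc k).erase i} => ν m.1 k)
  exact ⟨m.1, m.2, hm.symm⟩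

lemma minOther_le_minOther {ν ν' : VL → VR → ℝ} {i : VL} {k : VR}
    (hne : ((Nc k).erase i).Nonempty) {D : ℝ}
    (h : ∀ m ∈ (Nc k).erase i, ν m k ≤ ν' m k + D) :
    minOther Nc ν i k ≤ minOther Nc ν' i k + D := by
  obtain ⟨m, hm, he⟩ := exists_minOther_eq ν' hne
  rw [he]
  exact (minOther_le ν hm).trans (h m hm)

lemma abs_minOther_sub_le {ν ν' : VL → VR → ℝ} {i : VL} {k : VR}
    (hne : ((Nc k).erase i).Nonempty) {D : ℝ}
    (h : ∀ m ∈ (Nc k).erase i, |ν m k - ν' m k| ≤ D) :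
    |minOther Nc ν i k - minOther Nc ν' i k| ≤ D := by
  have h1 := minOther_le_minOther (ν := ν) (ν' := ν') hne (D := D) fun m hm => by
    have := (abs_le.1 (h m hm)).2; linarith
  have h2 := minOther_le_minOther (ν := ν') (ν' := ν) hne (D := D) fun m hm => by
    have := (abs_le.1 (h m hm)).1; linarith
  rw [abs_le]; constructor <;> linarith

lemma continuous_minOther {X : Type*} [TopologicalSpace X] {ν : X → VL → VR → ℝ}
    (hν : Continuous ν) {i : VL} {k : VR} (hne : ((Nc k).erase i).Nonempty) :
    Continuous fun x => minOther Nc (ν x) i k := by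
  have : Nonempty {m : VL // m ∈ (Nc k).erase i} := hne.to_subtype
  simp only [minOther, ← Finset.inf'_univ_eq_ciInf]
  exact Continuous.finset_inf'_apply _ fun m _ => by fun_prop

lemma c2b_eq_prod_mul_minOther (μ : VL → VR → ℝ) (i : VL) (k : VR) :
    c2b Nc μ i k =
      (∏ m ∈ (Nc k).erase i, Real.sign (μ m k)) * minOther Nc (fun m k => |μ m k|) i k := rfl

lemma abs_add_abs_le_of_sign_ne {a b : ℝ} (h : Real.sign a ≠ Real.sign b) :
    |a| + |b| ≤ |a - b| := by
  rcases lt_trichotomy a 0 with ha | rfl | ha <;> rcases lt_trichotomy b 0 with hb | rfl | hb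
  · simp [Real.sign_of_neg ha, Real.sign_of_neg hb] at h
  · simp
  · rw [abs_of_neg ha, abs_of_pos hb, abs_of_neg (by linarith)]; linarith
  · simp
  · simp
  · simp
  · rw [abs_of_pos ha, abs_of_neg hb, abs_of_pos (by linarith)]; linarith
  · simp
  · simp [Real.sign_of_pos ha, Real.sign_of_pos hb] at h

lemma abs_c2b_sub_le {μ μ' : VL → VR → ℝ} {i : VL} {k : VR}
    (hne : ((Nc k).erase i).Nonempty) {D : ℝ}
    (h : ∀ m ∈ (Nc k).erase i, |μ m k - μ' m k| ≤ D) :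
    |c2b Nc μ i k - c2b Nc μ' i k| ≤ D := by
  by_cases hs : ∀ m ∈ (Nc k).erase i, Real.sign (μ m k) = Real.sign (μ' m k)
  · rw [c2b_eq_prod_mul_minOther, c2b_eq_prod_mul_minOther, Finset.prod_congr rfl hs, ← mul_sub,
      abs_mul]
    refine (mul_le_of_le_one_left (abs_nonneg _) (abs_prod_sign_le_one _ _)).trans ?_
    exact abs_minOther_sub_le hne fun m hm => (abs_abs_sub_abs_le_abs_sub _ _).trans (h m hm)
  · push Not at hs
    obtain ⟨m, hm, hsm⟩ := hs
    have bound : ∀ η : VL → VR → ℝ, |c2b Nc η i k| ≤ |η m k| := fun η => by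
      rw [c2b_eq_prod_mul_minOther, abs_mul]
      refine (mul_le_of_le_one_left (abs_nonneg _) (abs_prod_sign_le_one _ _)).trans ?_
      rw [abs_of_nonneg (show 0 ≤ minOther Nc (fun m k => |η m k|) i k from
        Real.iInf_nonneg fun _ => abs_nonneg _)]
      exact minOther_le (fun m k => |η m k|) hm
    calc |c2b Nc μ i k - c2b Nc μ' i k| ≤ |c2b Nc μ i k| + |c2b Nc μ' i k| := abs_sub _ _
      _ ≤ |μ m k| + |μ' m k| := add_le_add (bound μ) (bound μ')
      _ ≤ |μ m k - μ' m k| := abs_add_abs_le_of_sign_ne hsm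
      _ ≤ D := h m hm

lemma sign_eq_of_mul_pos {s a : ℝ} (hs : s = 1 ∨ s = -1) (h : 0 < s * a) :
    Real.sign a = s := by
  rcases hs with rfl | rfl
  · exact Real.sign_of_pos (by linarith)
  · exact Real.sign_of_neg (by linarith)

lemma mul_self_of_eq_one_or_neg_one {s : ℝ} (hs : s = 1 ∨ s = -1) : s * s = 1 := by
  rcases hs with rfl | rfl <;> norm_num

/-- For messages whose signs at check `k` are given by `s`, the check-to-bit message is the
sign product times the smallest magnitude. -/
lemma c2b_eq_prod_mul {s : VL → ℝ} (hs : ∀ i, s i = 1 ∨ s i = -1) {μ : VL → VR → ℝ}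
    {i : VL} {k : VR} (hpos : ∀ m ∈ Nc k, 0 < s m * μ m k) :
    c2b Nc μ i k =
      (∏ m ∈ (Nc k).erase i, s m) * minOther Nc (fun m k => s m * μ m k) i k := by
  have habs : ∀ m ∈ Nc k, |μ m k| = s m * μ m k := fun m hm => by
    have := hpos m hm
    rcases hs m with h | h <;> rw [h] at this ⊢
    · rw [abs_of_pos (by linarith)]; ring
    · rw [abs_of_neg (by linarith)]; ring
  rw [c2b_eq_prod_mul_minOther]
  congr 1
  · exact Finset.prod_congr rfl fun m hm =>
      sign_eq_of_mul_pos (hs m) (hpos m (Finset.mem_of_mem_erase hm))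
  · exact iInf_congr fun m => habs m.1 (Finset.mem_of_mem_erase m.2)

lemma c2b_eq_mul_minOther {s : VL → ℝ} (hs : ∀ i, s i = 1 ∨ s i = -1) {μ : VL → VR → ℝ}
    {i : VL} {k : VR} (hi : i ∈ Nc k) (hprod : ∏ m ∈ Nc k, s m = 1)
    (hpos : ∀ m ∈ Nc k, 0 < s m * μ m k) :
    c2b Nc μ i k = s i * minOther Nc (fun m k => s m * μ m k) i k := by
  rw [c2b_eq_prod_mul hs hpos]
  congr 1
  rw [← Finset.mul_prod_erase _ _ hi] at hprod
  linear_combination s i * hprod - (∏ m ∈ (Nc k).erase i, s m) *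
    mul_self_of_eq_one_or_neg_one (hs i)

lemma minOther_pos {ν : VL → VR → ℝ} {i : VL} {k : VR} (hne : ((Nc k).erase i).Nonempty)
    (hpos : ∀ m ∈ Nc k, 0 < ν m k) : 0 < minOther Nc ν i k := by
  obtain ⟨m, hm, he⟩ := exists_minOther_eq ν hne
  rw [he]
  exact hpos m (Finset.mem_of_mem_erase hm)

/-- Messages whose check-to-bit signs agree with the bit-to-check signs have signs forming a
codeword. -/
lemma prod_sign_eq_one {s : VL → ℝ} (hs : ∀ i, s i = 1 ∨ s i = -1) {μ : VL → VR → ℝ}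
    {i : VL} {k : VR} (hi : i ∈ Nc k) (hne : ((Nc k).erase i).Nonempty)
    (hpos : ∀ m ∈ Nc k, 0 < s m * μ m k) (hc : Real.sign (c2b Nc μ i k) = Real.sign (μ i k)) :
    ∏ m ∈ Nc k, s m = 1 := by
  have hmin := minOther_pos (ν := fun m k => s m * μ m k) hne hpos
  have hP := prod_eq_one_or_neg_one ((Nc k).erase i) s hs
  rw [c2b_eq_prod_mul hs hpos, sign_eq_of_mul_pos (hs i) (hpos i hi),
    sign_eq_of_mul_pos hP (by
      rw [← mul_assoc, mul_self_of_eq_one_or_neg_one hP, one_mul]; exact hmin)] at hc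
  rw [← Finset.mul_prod_erase _ _ hi, hc, mul_self_of_eq_one_or_neg_one (hs i)]

end MinOther

lemma card_erase_cast {VL VR : Type*} [DecidableEq VR] {Nv : VL → Finset VR} {dv : ℕ}
    (hdv : ∀ i, (Nv i).card = dv) (hdv2 : 2 ≤ dv) {i : VL} {j : VR} (hj : j ∈ Nv i) :
    (((Nv i).erase j).card : ℝ) = (dv : ℝ) - 1 := by
  rw [Finset.card_erase_of_mem hj, hdv, Nat.cast_pred (by omega)]

section MinSumOp

variable {VL VR : Type*} [DecidableEq VL] [DecidableEq VR]
  {Nv : VL → Finset VR} {Nc : VR → Finset VL}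

lemma minSumOp_of_mem {σ : VL → ℝ} {β : ℝ} {ν : VL → VR → ℝ} {i : VL} {j : VR}
    (hj : j ∈ Nv i) :
    minSumOp Nv Nc σ β ν i j = σ i + β * ∑ k ∈ (Nv i).erase j, minOther Nc ν i k :=
  if_pos hj

lemma monotone_minSumOp (hne : ∀ i, ∀ k ∈ Nv i, ((Nc k).erase i).Nonempty) (σ : VL → ℝ)
    {β : ℝ} (hβ : 0 ≤ β) : Monotone (minSumOp Nv Nc σ β) := by
  intro ν ν' h i j
  unfold minSumOp
  split_ifs
  · gcongr with k hk
    simpa using minOther_le_minOther (ν := ν) (ν' := ν') (D := 0)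
      (hne i k (Finset.mem_of_mem_erase hk)) fun m _ => by simpa using h m k
  · exact le_rfl

lemma continuous_iterate_minSumOp (hne : ∀ i, ∀ k ∈ Nv i, ((Nc k).erase i).Nonempty)
    (σ : VL → ℝ) (ν : VL → VR → ℝ) (n : ℕ) :
    Continuous fun β => (minSumOp Nv Nc σ β)^[n] ν := by
  induction n with
  | zero => exact continuous_const
  | succ n ih =>
    simp only [Function.iterate_succ_apply']
    refine continuous_pi fun i => continuous_pi fun j => ?_
    unfold minSumOp
    split_ifs
    · refine continuous_const.add (continuous_id.mul (continuous_finsetSum _ fun k hk => ?_))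
      exact continuous_minOther ih (hne i k (Finset.mem_of_mem_erase hk))
    · exact continuous_const

lemma contracting_minSumOp [Fintype VL] [Fintype VR]
    {dv : ℕ} (hdv : ∀ i, (Nv i).card = dv) (hdv2 : 2 ≤ dv)
    (hne : ∀ i, ∀ k ∈ Nv i, ((Nc k).erase i).Nonempty) (σ : VL → ℝ)
    {δ : NNReal} (hδ : δ < 1) :
    ContractingWith δ (minSumOp Nv Nc σ (δ / ((dv : ℝ) - 1))) := by
  have hd : (0 : ℝ) < (dv : ℝ) - 1 := by
    have : (2 : ℝ) ≤ dv := by exact_mod_cast hdv2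
    linarith
  refine ⟨hδ, LipschitzWith.of_dist_le_mul fun ν ν' => ?_⟩
  have hD : 0 ≤ (δ : ℝ) * dist ν ν' := by positivity
  refine (dist_pi_le_iff hD).2 fun i => (dist_pi_le_iff hD).2 fun j => ?_
  by_cases hj : j ∈ Nv i
  · rw [minSumOp_of_mem hj, minSumOp_of_mem hj, Real.dist_eq]
    refine (abs_affine_sum_sub_le _ _ _ _ _ (dist ν ν') (by positivity) fun k hk =>
      abs_minOther_sub_le (hne i k (Finset.mem_of_mem_erase hk)) fun m _ => ?_).trans_eq ?_
    · rw [← Real.dist_eq]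
      exact (dist_le_pi_dist (ν m) (ν' m) k).trans (dist_le_pi_dist ν ν' m)
    · rw [card_erase_cast hdv hdv2 hj]
      field_simp
  · simpa [minSumOp, hj] using hD

lemma abs_Wop_sub_le {dv : ℕ} (hdv : ∀ i, (Nv i).card = dv) (hdv2 : 2 ≤ dv)
    (hne : ∀ i, ∀ k ∈ Nv i, ((Nc k).erase i).Nonempty)
    (hsym : ∀ (i : VL) (j : VR), j ∈ Nv i ↔ i ∈ Nc j) (γ : VL → ℝ) {δ D : ℝ} (hδ : 0 ≤ δ)
    {μ μ' : VL → VR → ℝ} (h : ∀ i, ∀ j ∈ Nv i, |μ i j - μ' i j| ≤ D) :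
    ∀ i, ∀ j ∈ Nv i, |Wop Nv Nc γ (δ / ((dv : ℝ) - 1)) μ i j -
      Wop Nv Nc γ (δ / ((dv : ℝ) - 1)) μ' i j| ≤ δ * D := by
  intro i j hj
  have hd : (0 : ℝ) < (dv : ℝ) - 1 := by
    have : (2 : ℝ) ≤ dv := by exact_mod_cast hdv2
    linarith
  refine (abs_affine_sum_sub_le _ _ _ _ _ D (by positivity) fun k hk =>
    abs_c2b_sub_le (hne i k (Finset.mem_of_mem_erase hk)) fun m hm =>
      h m k ((hsym m k).2 (Finset.mem_of_mem_erase hm))).trans_eq ?_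
  rw [card_erase_cast hdv hdv2 hj]
  field_simp

lemma tendsto_wmsIter [Fintype VL] [Fintype VR]
    {dv : ℕ} (hdv : ∀ i, (Nv i).card = dv) (hdv2 : 2 ≤ dv)
    (hne : ∀ i, ∀ k ∈ Nv i, ((Nc k).erase i).Nonempty)
    (hsym : ∀ (i : VL) (j : VR), j ∈ Nv i ↔ i ∈ Nc j) (γ : VL → ℝ) {δ : ℝ} (hδ : 0 ≤ δ)
    (hδ1 : δ < 1) {μs : VL → VR → ℝ}
    (hfix : ∀ i, ∀ j ∈ Nv i, μs i j = Wop Nv Nc γ (δ / ((dv : ℝ) - 1)) μs i j) :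
    ∀ i, ∀ j ∈ Nv i, Tendsto (fun n => wmsIter Nv Nc γ (δ / ((dv : ℝ) - 1)) n i j) atTop
      (nhds (μs i j)) := by
  set C : ℝ := dist (fun i (_ : VR) => γ i) μs with hC
  have key : ∀ n, ∀ i, ∀ j ∈ Nv i,
      |wmsIter Nv Nc γ (δ / ((dv : ℝ) - 1)) n i j - μs i j| ≤ δ ^ n * C := by
    intro n
    induction n with
    | zero =>
      intro i j _
      rw [pow_zero, one_mul, ← Real.dist_eq]
      exact (dist_le_pi_dist (fun _ : VR => γ i) (μs i) j).trans
        (dist_le_pi_dist (fun i (_ : VR) => γ i) μs i)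
    | succ n ih =>
      intro i j hj
      rw [hfix i j hj, wmsIter, Function.iterate_succ_apply', pow_succ', mul_assoc]
      exact abs_Wop_sub_le hdv hdv2 hne hsym γ hδ ih i j hj
  intro i j hj
  rw [tendsto_iff_dist_tendsto_zero]
  refine squeeze_zero (fun _ => dist_nonneg) (fun n => ?_)
    (by simpa using (tendsto_pow_atTop_nhds_zero_of_lt_one hδ hδ1).mul_const C)
  rw [Real.dist_eq]
  exact key n i j hj

/-- A positive fixed point of `minSumOp` certifies that `σ` has nonnegative total weight on
every set of variables that meets no check neighborhood in exactly one element. -/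
lemma sum_nonneg_of_fixedPoint [Fintype VR]
    {dv : ℕ} (hdv : ∀ i, (Nv i).card = dv) (hdv2 : 2 ≤ dv)
    (hsym : ∀ (i : VL) (j : VR), j ∈ Nv i ↔ i ∈ Nc j) {σ : VL → ℝ} {δ : ℝ} (hδ : 0 ≤ δ)
    (hδ1 : δ < 1) {ν : VL → VR → ℝ}
    (hfix : ∀ i, ∀ j ∈ Nv i, ν i j = minSumOp Nv Nc σ (δ / ((dv : ℝ) - 1)) ν i j)
    (hpos : ∀ i, ∀ j ∈ Nv i, 0 < ν i j) (Y : Finset VL)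
    (hY : ∀ k, ((Nc k).filter (· ∈ Y)).card ≠ 1) : 0 ≤ ∑ i ∈ Y, σ i := by
  have hd : (0 : ℝ) < (dv : ℝ) - 1 := by
    have : (2 : ℝ) ≤ dv := by exact_mod_cast hdv2
    linarith
  have swap : ∀ g : VL → VR → ℝ, ∑ i ∈ Y, ∑ k ∈ Nv i, g i k =
      ∑ k, ∑ i ∈ (Nc k).filter (· ∈ Y), g i k := fun g =>
    Finset.sum_comm' fun i k => by simp [hsym, and_comm]
  have total : ∑ i ∈ Y, ∑ j ∈ Nv i, ν i j =
      dv * ∑ i ∈ Y, σ i + δ * ∑ i ∈ Y, ∑ k ∈ Nv i, minOther Nc ν i k := by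
    rw [Finset.mul_sum, Finset.mul_sum, ← Finset.sum_add_distrib]
    refine Finset.sum_congr rfl fun i _ => ?_
    rw [Finset.sum_congr rfl fun j hj => (hfix i j hj).trans (minSumOp_of_mem hj),
      Finset.sum_add_distrib, ← Finset.mul_sum, sum_sum_erase, hdv, Finset.sum_const, hdv,
      nsmul_eq_mul]
    field_simp
  have hle : ∑ i ∈ Y, ∑ k ∈ Nv i, minOther Nc ν i k ≤ ∑ i ∈ Y, ∑ k ∈ Nv i, ν i k := by
    rw [swap, swap]
    refine Finset.sum_le_sum fun k _ => sum_le_sum_of_le_of_ne _ (hY k) _ _ ?_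
    intro i _ m hm hmi
    exact minOther_le ν (Finset.mem_erase.2 ⟨hmi, (Finset.mem_filter.1 hm).1⟩)
  have h0 : 0 ≤ ∑ i ∈ Y, ∑ k ∈ Nv i, ν i k :=
    Finset.sum_nonneg fun i _ => Finset.sum_nonneg fun j hj => (hpos i j hj).le
  have hdpos : (0 : ℝ) < dv := by linarith
  refine nonneg_of_mul_nonneg_right ?_ hdpos
  nlinarith [mul_le_mul_of_nonneg_left hle hδ]

end MinSumOp

/-- The codeword with signs `s` has least cost if `s · γ` has nonnegative total weight on every
set of variables that meets no check neighborhood in exactly one element. -/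
lemma sum_mul_le_of_isCodewordR {VL VR : Type*} [Fintype VL] [DecidableEq VL]
    {Nc : VR → Finset VL} {γ s : VL → ℝ} (hs : ∀ i, s i = 1 ∨ s i = -1)
    (hc : IsCodewordR Nc fun i => (1 - s i) / 2)
    (h : ∀ Y : Finset VL, (∀ k, ((Nc k).filter (· ∈ Y)).card ≠ 1) → 0 ≤ ∑ i ∈ Y, s i * γ i)
    {x : VL → ℝ} (hx : IsCodewordR Nc x) :
    ∑ i, γ i * ((1 - s i) / 2) ≤ ∑ i, γ i * x i := by
  classical
  set Y : Finset VL := Finset.univ.filter fun i => x i ≠ (1 - s i) / 2 with hYdef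
  have hdiff : ∀ i ∈ Y, x i - (1 - s i) / 2 = s i := by
    intro i hi
    have hi := (Finset.mem_filter.1 hi).2
    rcases hs i with h1 | h1 <;> rcases hx.1 i with h2 | h2 <;> rw [h1, h2] at hi ⊢ <;>
      revert hi <;> norm_num
  have hsame : ∀ i, i ∉ Y → x i - (1 - s i) / 2 = 0 := by
    intro i hi
    have : x i = (1 - s i) / 2 := by simpa [hYdef] using hi
    rw [this, sub_self]
  have hcard : ∀ k, ((Nc k).filter (· ∈ Y)).card ≠ 1 := by
    intro k hk
    obtain ⟨a, ha⟩ := Finset.card_eq_one.1 hk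
    obtain ⟨m, hm⟩ := hx.2 k
    obtain ⟨m', hm'⟩ := hc.2 k
    have haY : a ∈ Y := (Finset.mem_filter.1 (ha ▸ Finset.mem_singleton_self a)).2
    have hsum : ∑ i ∈ Nc k, (x i - (1 - s i) / 2) = s a := by
      rw [← Finset.sum_filter_add_sum_filter_not (Nc k) (· ∈ Y), ha, Finset.sum_singleton,
        hdiff a haY, Finset.sum_eq_zero fun i hi => hsame i (Finset.mem_filter.1 hi).2, add_zero]
    rw [Finset.sum_sub_distrib, hm, hm'] at hsum
    rcases hs a with h1 | h1 <;> rw [h1] at hsum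
    · have : 2 * m - 2 * m' = 1 := by exact_mod_cast hsum
      omega
    · have : 2 * m - 2 * m' = -1 := by exact_mod_cast hsum
      omega
  have hY := h Y hcard
  have : ∑ i, γ i * x i - ∑ i, γ i * ((1 - s i) / 2) = ∑ i ∈ Y, s i * γ i := by
    rw [← Finset.sum_sub_distrib]
    symm
    refine Finset.sum_subset_zero_on_sdiff (Finset.subset_univ Y) (fun i hi => ?_) fun i hi => ?_
    · rw [← mul_sub, hsame i (Finset.mem_sdiff.1 hi).2, mul_zero]
    · rw [← mul_sub, hdiff i hi, mul_comm]
  linarith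

/-- A divergent and consistent sequence has a limiting sign at every variable node. -/
lemma exists_sign_of_divergentConsistent {VL VR : Type*} [DecidableEq VL] [DecidableEq VR]
    {Nv : VL → Finset VR} {Nc : VR → Finset VL} {γ : VL → ℝ} {dv : ℕ} {μ : ℕ → VL → VR → ℝ}
    (hdiv : DivergentConsistent Nv Nc γ dv μ) (i : VL) :
    ∃ s : ℝ, (s = 1 ∨ s = -1) ∧
      ∀ j ∈ Nv i, Tendsto (fun ℓ => s * μ ℓ i j) atTop atTop := by
  obtain ⟨htend, L, -, hL⟩ := hdiv
  have hnot : ∀ j ∈ Nv i, ∀ j' ∈ Nv i, Tendsto (fun ℓ => μ ℓ i j) atTop atTop →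
      ¬ Tendsto (fun ℓ => μ ℓ i j') atTop atBot := by
    intro j hj j' hj' h1 h2
    obtain ⟨ℓ, hℓ1, hℓ2, hℓ⟩ := ((h1.eventually_gt_atTop 0).and
      ((h2.eventually_lt_atBot 0).and (eventually_ge_atTop L))).exists
    have := (hL ℓ hℓ).2.1 i j hj j' hj'
    rw [Real.sign_of_pos hℓ1, Real.sign_of_neg hℓ2] at this
    norm_num at this
  by_cases h : ∃ j ∈ Nv i, Tendsto (fun ℓ => μ ℓ i j) atTop atTop
  · obtain ⟨j, hj, h1⟩ := h
    refine ⟨1, Or.inl rfl, fun j' hj' => ?_⟩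
    simpa using (htend i j' hj').resolve_right (hnot j hj j' hj' h1)
  · push Not at h
    refine ⟨-1, Or.inr rfl, fun j hj => ?_⟩
    simpa only [neg_one_mul, Function.comp_def] using
      tendsto_neg_atBot_atTop.comp ((htend i j hj).resolve_left (h j hj))

/-- If the WMS iterates with parameter `1/(d_v−1)` are divergent and
consistent, then for some `δ ∈ [0,1)` and `L0 > 0` the WMS iterates with parameter
`δ/(d_v−1)` converge to a WMS-consistent fixed point whose hard decision vector equals the
hard decision vector of `μ^{(L0)}`, and this common vector is a maximum-likelihood
codeword. -/
theorem wms_divergent_consistent_is_ML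
    {VL VR : Type*} [Fintype VL] [Fintype VR] [DecidableEq VL] [DecidableEq VR]
    [Nonempty VL] [Nonempty VR]
    (Nv : VL → Finset VR) (Nc : VR → Finset VL) (dv dc : ℕ)
    (hsym : ∀ (i : VL) (j : VR), j ∈ Nv i ↔ i ∈ Nc j)
    (hdv : ∀ i : VL, (Nv i).card = dv) (hdc : ∀ j : VR, (Nc j).card = dc)
    (hdv2 : 2 ≤ dv) (hdc2 : 2 ≤ dc)
    (γ : VL → ℝ)
    (μ1 : ℕ → VL → VR → ℝ)
    (hμ1 : μ1 = wmsIter Nv Nc γ (1 / ((dv : ℝ) - 1)))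
    (hdiv : DivergentConsistent Nv Nc γ dv μ1) :
    ∃ δ : ℝ, 0 ≤ δ ∧ δ < 1 ∧ ∃ L0 : ℕ, 0 < L0 ∧ ∃ μs : VL → VR → ℝ,
      (∀ i : VL, ∀ j ∈ Nv i,
        Tendsto (fun n => wmsIter Nv Nc γ (δ / ((dv : ℝ) - 1)) n i j) atTop
          (nhds (μs i j))) ∧
      (∀ i : VL, ∀ j ∈ Nv i, μs i j = Wop Nv Nc γ (δ / ((dv : ℝ) - 1)) μs i j) ∧
      WMSConsistent Nv Nc γ (δ / ((dv : ℝ) - 1)) μs ∧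
      hardDec Nv Nc γ (δ / ((dv : ℝ) - 1)) μs =
        hardDec Nv Nc γ (1 / ((dv : ℝ) - 1)) (μ1 L0) ∧
      IsCodewordR Nc (hardDec Nv Nc γ (δ / ((dv : ℝ) - 1)) μs) ∧
      (∀ x : VL → ℝ, IsCodewordR Nc x →
        ∑ i : VL, γ i * hardDec Nv Nc γ (δ / ((dv : ℝ) - 1)) μs i ≤
          ∑ i : VL, γ i * x i) := by
  have hd : (0 : ℝ) < (dv : ℝ) - 1 := by
    have : (2 : ℝ) ≤ dv := by exact_mod_cast hdv2
    linarith
  have hne : ∀ i, ∀ k ∈ Nv i, ((Nc k).erase i).Nonempty := fun i k hk => by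
    rw [← Finset.card_pos, Finset.card_erase_of_mem ((hsym i k).1 hk), hdc]
    omega
  have hNv : ∀ i, (Nv i).Nonempty := fun i => by
    rw [← Finset.card_pos, hdv]
    omega
  choose s hs htend using exists_sign_of_divergentConsistent hdiv
  have hss : ∀ i, s i * s i = 1 := fun i => mul_self_of_eq_one_or_neg_one (hs i)
  obtain ⟨-, L, hLpos, hL⟩ := hdiv
  have hev : ∀ B : VL → VR → ℝ, ∀ᶠ ℓ in atTop, ∀ i, ∀ j ∈ Nv i, B i j < s i * μ1 ℓ i j :=
    fun B => eventually_all.2 fun i => eventually_all.2 fun j => by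
      by_cases hj : j ∈ Nv i
      · filter_upwards [(htend i j hj).eventually_gt_atTop (B i j)] with ℓ hℓ _ using hℓ
      · exact Eventually.of_forall fun ℓ h => absurd h hj
  obtain ⟨M, hM⟩ := eventually_atTop.1 (hev 0)
  set L0 := max L M with hL0
  have hpos : ∀ ℓ ≥ L0, ∀ i, ∀ j ∈ Nv i, 0 < s i * μ1 ℓ i j := fun ℓ hℓ =>
    hM ℓ ((le_max_right L M).trans hℓ)
  have hcons := hL L0 (le_max_left L M)
  have hprod : ∀ k, ∏ m ∈ Nc k, s m = 1 := by
    intro k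
    obtain ⟨i, hi⟩ : (Nc k).Nonempty := by
      rw [← Finset.card_pos, hdc]
      omega
    have hik := (hsym i k).2 hi
    exact prod_sign_eq_one hs hi (hne i k hik)
      (fun m hm => hpos L0 le_rfl m k ((hsym m k).2 hm)) (hcons.2.2.1 i k hik)
  have hc2b : ∀ μ : VL → VR → ℝ, (∀ i, ∀ j ∈ Nv i, 0 < s i * μ i j) → ∀ i, ∀ k ∈ Nv i,
      c2b Nc μ i k = s i * minOther Nc (fun m k => s m * μ m k) i k := fun μ hμ i k hk =>
    c2b_eq_mul_minOther hs ((hsym i k).1 hk) (hprod k) fun m hm => hμ m k ((hsym m k).2 hm)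
  have hWop : ∀ β, ∀ μ : VL → VR → ℝ, (∀ i, ∀ j ∈ Nv i, 0 < s i * μ i j) → ∀ i, ∀ j ∈ Nv i,
      s i * Wop Nv Nc γ β μ i j =
        minSumOp Nv Nc (fun i => s i * γ i) β (fun m k => s m * μ m k) i j := by
    intro β μ hμ i j hj
    rw [minSumOp_of_mem hj, Wop, Finset.sum_congr rfl fun k hk =>
      hc2b μ hμ i k (Finset.mem_of_mem_erase hk), ← Finset.mul_sum]
    linear_combination (β * ∑ k ∈ (Nv i).erase j,
      minOther Nc (fun m k => s m * μ m k) i k) * hss i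
  have hcongr : ∀ β, ∀ ν ν' : VL → VR → ℝ, (∀ i, ∀ j ∈ Nv i, ν i j = ν' i j) →
      minSumOp Nv Nc (fun i => s i * γ i) β ν = minSumOp Nv Nc (fun i => s i * γ i) β ν' := by
    intro β ν ν' h
    funext i j
    unfold minSumOp
    congr 3
    exact Finset.sum_congr rfl fun k _ => iInf_congr fun m =>
      h m.1 k ((hsym m.1 k).2 (Finset.mem_of_mem_erase m.2))
  set ν : ℕ → VL → VR → ℝ := fun ℓ i j => if j ∈ Nv i then s i * μ1 ℓ i j else 0 with hν
  have hνstep : ∀ ℓ ≥ L0,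
      minSumOp Nv Nc (fun i => s i * γ i) (1 / ((dv : ℝ) - 1)) (ν ℓ) = ν (ℓ + 1) := by
    intro ℓ hℓ
    rw [hcongr _ (ν ℓ) (fun m k => s m * μ1 ℓ m k) fun i j hj => if_pos hj]
    funext i j
    by_cases hj : j ∈ Nv i
    · rw [← hWop _ _ (hpos ℓ hℓ) i j hj]
      simp only [hν, if_pos hj, hμ1, wmsIter, Function.iterate_succ_apply']
    · simp [hν, minSumOp, hj]
  have hνiter : ∀ p,
      (minSumOp Nv Nc (fun i => s i * γ i) (1 / ((dv : ℝ) - 1)))^[p] (ν L0) = ν (L0 + p) := by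
    intro p
    induction p with
    | zero => rfl
    | succ p ih =>
      rw [Function.iterate_succ_apply', ih, hνstep _ (by omega), add_assoc]
  obtain ⟨ℓ, hℓ, hL0ℓ⟩ := ((hev (ν L0)).and (eventually_gt_atTop L0)).exists
  obtain ⟨p, rfl⟩ := Nat.exists_eq_add_of_lt hL0ℓ
  rw [add_assoc] at hℓ
  have hcont : ∀ i j, Continuous fun δ : ℝ =>
      (minSumOp Nv Nc (fun i => s i * γ i) (δ / ((dv : ℝ) - 1)))^[p + 1] (ν L0) i j :=
    fun i j => (continuous_apply j).comp ((continuous_apply i).comp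
      ((continuous_iterate_minSumOp hne _ (ν L0) (p + 1)).comp (continuous_id.div_const _)))
  have hnear : ∀ᶠ δ : ℝ in nhds 1, ∀ i, ∀ j ∈ Nv i, ν L0 i j <
      (minSumOp Nv Nc (fun i => s i * γ i) (δ / ((dv : ℝ) - 1)))^[p + 1] (ν L0) i j := by
    refine eventually_all.2 fun i => eventually_all.2 fun j => ?_
    by_cases hj : j ∈ Nv i
    · have h1 := hℓ i j hj
      have h2 : ν L0 i j < (minSumOp Nv Nc (fun i => s i * γ i)
          (1 / ((dv : ℝ) - 1)))^[p + 1] (ν L0) i j := by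
        rw [hνiter]
        simpa only [hν, if_pos hj] using h1
      filter_upwards [(hcont i j).continuousAt.eventually_const_lt h2] with δ hδ _ using hδ
    · exact Eventually.of_forall fun δ h => absurd h hj
  obtain ⟨δ', hδle, hδ0, hδ1⟩ := ((hnear.filter_mono nhdsWithin_le_nhds).and
    (Ioo_mem_nhdsLT (zero_lt_one' ℝ))).exists
  lift δ' to NNReal using hδ0.le with δ
  set F := minSumOp Nv Nc (fun i => s i * γ i) (δ / ((dv : ℝ) - 1)) with hF
  have hcontr : ContractingWith δ F :=
    contracting_minSumOp hdv hdv2 hne _ (by exact_mod_cast hδ1)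
  have hle : ν L0 ≤ F^[p + 1] (ν L0) := by
    intro i j
    by_cases hj : j ∈ Nv i
    · exact (hδle i j hj).le
    · rw [Function.iterate_succ_apply']
      simp [hν, hF, minSumOp, hj]
  have hmono : Monotone F := monotone_minSumOp hne _ (by positivity)
  set νs := ContractingWith.fixedPoint F hcontr with hνs
  have hfixF : F νs = νs := hcontr.fixedPoint_isFixedPt
  have hνs_ge : ν L0 ≤ νs := by
    refine ge_of_tendsto' ((hcontr.tendsto_iterate_fixedPoint (ν L0)).comp
      (tendsto_id.const_mul_atTop' (Nat.succ_pos p))) fun n => ?_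
    simp only [Function.comp_apply, id, Nat.succ_eq_add_one, Function.iterate_mul]
    exact (hmono.iterate (p + 1)).monotone_iterate_of_le_map hle (Nat.zero_le n)
  have hνpos : ∀ i, ∀ j ∈ Nv i, 0 < νs i j := fun i j hj =>
    (hpos L0 le_rfl i j hj).trans_le (by simpa only [hν, if_pos hj] using hνs_ge i j)
  set μs : VL → VR → ℝ := fun i j => s i * νs i j with hμs
  have hsμ : (fun i j => s i * μs i j) = νs := by
    funext i j
    rw [hμs, ← mul_assoc, hss, one_mul]
  have hμpos : ∀ i, ∀ j ∈ Nv i, 0 < s i * μs i j := fun i j hj => by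
    rw [congrFun (congrFun hsμ i) j]
    exact hνpos i j hj
  have hfix : ∀ i, ∀ j ∈ Nv i, μs i j = Wop Nv Nc γ (δ / ((dv : ℝ) - 1)) μs i j := by
    intro i j hj
    have h1 := hWop (δ / ((dv : ℝ) - 1)) μs hμpos i j hj
    rw [hsμ, ← hF, hfixF] at h1
    linear_combination s i * h1.symm + Wop Nv Nc γ (δ / ((dv : ℝ) - 1)) μs i j * hss i
  have hminpos : ∀ i, ∀ k ∈ Nv i, 0 < minOther Nc νs i k := fun i k hk =>
    minOther_pos (hne i k hk) fun m hm => hνpos m k ((hsym m k).2 hm)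
  have hc2bs : ∀ i, ∀ k ∈ Nv i, c2b Nc μs i k = s i * minOther Nc νs i k := fun i k hk => by
    rw [hc2b μs hμpos i k hk, hsμ]
  have hsign : ∀ i, ∀ j ∈ Nv i, Real.sign (μs i j) = s i := fun i j hj =>
    sign_eq_of_mul_pos (hs i) (hμpos i j hj)
  have hpost : ∀ i, Real.sign (γ i + δ / ((dv : ℝ) - 1) * ∑ j ∈ Nv i, c2b Nc μs i j) = s i := by
    intro i
    obtain ⟨j, hj⟩ := hNv i
    refine sign_eq_of_mul_pos (hs i) ?_
    have h1 : s i * (γ i + δ / ((dv : ℝ) - 1) * ∑ j ∈ Nv i, c2b Nc μs i j) =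
        s i * μs i j + δ / ((dv : ℝ) - 1) * minOther Nc νs i j := by
      rw [hfix i j hj, Wop, ← Finset.add_sum_erase _ _ hj, hc2bs i j hj]
      linear_combination δ / ((dv : ℝ) - 1) * minOther Nc νs i j * hss i
    rw [h1]
    have := hminpos i j hj
    have := hμpos i j hj
    positivity
  have hdec : hardDec Nv Nc γ (δ / ((dv : ℝ) - 1)) μs = fun i => (1 - s i) / 2 := by
    funext i
    rw [hardDec, hpost]
  have hcode : IsCodewordR Nc fun i => (1 - s i) / 2 :=
    ⟨fun i => by rcases hs i with h | h <;> norm_num [h],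
      fun k => exists_two_mul_of_prod_eq_one _ s hs (hprod k)⟩
  refine ⟨δ, δ.2, hδ1, L0, hLpos.trans_le (le_max_left L M), μs,
    tendsto_wmsIter hdv hdv2 hne hsym γ δ.2 hδ1 hfix, hfix, ⟨?_, ?_, ?_, ?_⟩, ?_, ?_, ?_⟩
  · intro i j hj h0
    have := hμpos i j hj
    rw [h0, mul_zero] at this
    exact this.false
  · intro i j hj j' hj'
    rw [hsign i j hj, hsign i j' hj']
  · intro i j hj
    rw [hsign i j hj, hc2bs i j hj]
    refine sign_eq_of_mul_pos (hs i) ?_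
    rw [← mul_assoc, hss, one_mul]
    exact hminpos i j hj
  · intro i j hj
    rw [hpost, hsign i j hj]
  · rw [hdec]
    funext i
    obtain ⟨j, hj⟩ := hNv i
    rw [hardDec, hcons.2.2.2 i j hj, sign_eq_of_mul_pos (hs i) (hpos L0 le_rfl i j hj)]
  · rw [hdec]
    exact hcode
  · intro x hx
    rw [hdec]
    exact sum_mul_le_of_isCodewordR hs hcode (fun Y hY =>
      sum_nonneg_of_fixedPoint hdv hdv2 hsym δ.2 hδ1
        (fun i j _ => (congrFun (congrFun hfixF i) j).symm) hνpos Y hY) hx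
end

section
/- Let S be a finite nonempty set and let μ_m(0), μ_m(1) ∈ ℝ for each m ∈ S; set a_m = μ_m(0) − μ_m(1). Then max over binary vectors w : S → {0,1} with Σ_{m∈S} w_m even of Σ_{m∈S} μ_m(w_m), minus max over binary vectors w : S → {0,1} with Σ_{m∈S} w_m odd of Σ_{m∈S} μ_m(w_m), equals (Π_{m∈S} sgn(a_m)) · min_{m∈S} |a_m|. (This identity establishes that the WMS check-node update rule computes the difference of the two AMP check-node values.) -/
open Finset

/-- The even-weight binary assignments on a finite index set, relative to a finset `S`. -/
def evenW {α : Type*} [Fintype α] [DecidableEq α] (S : Finset α) : Finset (α → Bool) :=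
  Finset.univ.filter (fun w => Even ((S.filter (fun m => w m = true)).card))

/-- The odd-weight binary assignments on a finite index set, relative to a finset `S`. -/
def oddW {α : Type*} [Fintype α] [DecidableEq α] (S : Finset α) : Finset (α → Bool) :=
  Finset.univ.filter (fun w => ¬ Even ((S.filter (fun m => w m = true)).card))

/-- Flipping one coordinate in `S` flips the parity of the weight on `S`. -/
theorem even_card_filter_update_not {α : Type*} [DecidableEq α] {S : Finset α} {a : α}
    (ha : a ∈ S) (w : α → Bool) :
    Even (S.filter (fun m => Function.update w a (!w a) m = true)).card ↔
      ¬ Even (S.filter (fun m => w m = true)).card := by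
  obtain ⟨T, haT, rfl⟩ : ∃ T, a ∉ T ∧ insert a T = S :=
    ⟨S.erase a, Finset.notMem_erase a S, Finset.insert_erase ha⟩
  have hT : T.filter (fun m => Function.update w a (!w a) m = true) =
      T.filter (fun m => w m = true) := by
    refine Finset.filter_congr fun m hm => ?_
    rw [Function.update_of_ne (ne_of_mem_of_not_mem hm haT)]
  rw [Finset.filter_insert, Finset.filter_insert, hT]
  cases h : w a <;> simp [haT, Nat.even_add_one]

/-- A supremum over a finset that is attained at `w` equals the value at `w`. -/
theorem iSup_mem_finset_eq_of_forall_le {β : Type*} {T : Finset β} {f : β → ℝ} {c : ℝ} {w : β}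
    (hw : w ∈ T) (hc : f w = c) (hle : ∀ v ∈ T, f v ≤ c) :
    (⨆ v : {v : β // v ∈ T}, f v.1) = c := by
  have : Nonempty {v : β // v ∈ T} := ⟨⟨w, hw⟩⟩
  refine le_antisymm (ciSup_le fun v => hle v.1 v.2) ?_
  rw [← hc]
  exact le_ciSup (f := fun v : {v : β // v ∈ T} => f v.1)
    ⟨c, by rintro _ ⟨v, rfl⟩; exact hle v.1 v.2⟩ ⟨w, hw⟩

/-- The loss of a binary choice between `x` and `y` relative to their maximum. -/
theorem ite_eq_max_sub_ite_abs (x y : ℝ) (b : Bool) :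
    (if b then y else x) = max x y - if b = decide (x - y < 0) then 0 else |x - y| := by
  by_cases h : x - y < 0
  · have h' : x ≤ y := by linarith
    cases b <;> simp [h, max_eq_right h', abs_of_neg h]
  · have h' : y ≤ x := by linarith
    cases b <;> simp [h, max_eq_left h', abs_of_nonneg (not_lt.mp h)]

/-- A product of signs of nonzero reals is determined by the parity of the negative ones. -/
theorem prod_sign_eq_neg_one_pow {α : Type*} {S : Finset α} {a : α → ℝ}
    (ha : ∀ m ∈ S, a m ≠ 0) :
    ∏ m ∈ S, Real.sign (a m) =
      (-1) ^ (S.filter (fun m => decide (a m < 0) = true)).card := by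
  have h : ∀ m ∈ S, Real.sign (a m) = if decide (a m < 0) = true then -1 else 1 := by
    intro m hm
    rcases lt_or_gt_of_ne (ha m hm) with h | h
    · simp [Real.sign_of_neg h, h]
    · simp [Real.sign_of_pos h, h.le]
  rw [Finset.prod_congr rfl h, Finset.prod_ite]
  simp

/-- For reals `μ_m(0), μ_m(1)` indexed by a finite nonempty set `S`, with
`a_m = μ_m(0) − μ_m(1)`, the difference between the maximum of `Σ_{m∈S} μ_m(w_m)` over
even-weight binary `w` and its maximum over odd-weight binary `w` equals
`(Π_{m∈S} sgn(a_m)) · min_{m∈S} |a_m|`. -/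
theorem check_node_min_sum_identity {α : Type*} [Fintype α] [DecidableEq α]
    (S : Finset α) (hS : S.Nonempty) (μ0 μ1 : α → ℝ) :
    (⨆ w : {w : α → Bool // w ∈ evenW S}, ∑ m ∈ S, (if w.1 m then μ1 m else μ0 m)) -
      (⨆ w : {w : α → Bool // w ∈ oddW S}, ∑ m ∈ S, (if w.1 m then μ1 m else μ0 m)) =
      (∏ m ∈ S, Real.sign (μ0 m - μ1 m)) * ⨅ m : {m : α // m ∈ S}, |μ0 m.1 - μ1 m.1| := by
  obtain ⟨k, hk, hmin⟩ := S.exists_min_image (fun m => |μ0 m - μ1 m|) hS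
  have hinf : (⨅ m : {m : α // m ∈ S}, |μ0 m.1 - μ1 m.1|) = |μ0 k - μ1 k| := by
    have : Nonempty {m : α // m ∈ S} := ⟨⟨k, hk⟩⟩
    refine le_antisymm ?_ (le_ciInf fun m => hmin m.1 m.2)
    exact ciInf_le (f := fun m : {m : α // m ∈ S} => |μ0 m.1 - μ1 m.1|)
      ⟨0, by rintro _ ⟨m, rfl⟩; exact abs_nonneg _⟩ ⟨k, hk⟩
  rw [hinf]
  set f : (α → Bool) → ℝ := fun w => ∑ m ∈ S, (if w m then μ1 m else μ0 m)
  set M : ℝ := ∑ m ∈ S, max (μ0 m) (μ1 m)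
  set p : α → Bool := fun m => decide (μ0 m - μ1 m < 0) with hp
  set q : α → Bool := Function.update p k (!p k) with hq
  have hf : ∀ w, f w = M - ∑ m ∈ S, if w m = p m then 0 else |μ0 m - μ1 m| := fun w => by
    rw [← Finset.sum_sub_distrib]
    exact Finset.sum_congr rfl fun m _ => ite_eq_max_sub_ite_abs _ _ _
  have hnn : ∀ w : α → Bool, ∀ m ∈ S, 0 ≤ if w m = p m then 0 else |μ0 m - μ1 m| := by
    intro w m _
    split_ifs
    exacts [le_rfl, abs_nonneg _]
  have hfp : f p = M := by simp [hf]
  have hle : ∀ w, f w ≤ M := fun w => by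
    rw [hf]
    linarith [Finset.sum_nonneg (hnn w)]
  have hfq : f q = M - |μ0 k - μ1 k| := by
    rw [hf, Finset.sum_eq_single_of_mem k hk]
    · simp [hq]
    · intro m _ hmk
      simp [hq, Function.update_of_ne hmk]
  have hle' : ∀ w, ¬ (Even (S.filter (fun m => w m = true)).card ↔
      Even (S.filter (fun m => p m = true)).card) → f w ≤ M - |μ0 k - μ1 k| := by
    intro w hw
    obtain ⟨m, hm, hne⟩ : ∃ m ∈ S, w m ≠ p m := by
      by_contra! h
      apply hw
      rw [Finset.filter_congr fun m hm => by rw [h m hm]]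
    have h := Finset.single_le_sum (hnn w) hm
    rw [if_neg hne] at h
    rw [hf]
    linarith [hmin m hm]
  have hpar := even_card_filter_update_not hk p
  rw [← hq] at hpar
  have hsign : (∏ m ∈ S, Real.sign (μ0 m - μ1 m)) * |μ0 k - μ1 k| =
      (-1) ^ (S.filter (fun m => p m = true)).card * |μ0 k - μ1 k| := by
    by_cases h0 : μ0 k - μ1 k = 0
    · simp [h0]
    · rw [prod_sign_eq_neg_one_pow]
      intro m hm hm0
      have h := hmin m hm
      simp only [hm0, abs_zero] at h
      exact h0 (abs_nonpos_iff.mp h)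
  rw [hsign]
  by_cases he : Even (S.filter (fun m => p m = true)).card
  · have h1 : (⨆ w : {w : α → Bool // w ∈ evenW S}, f w.1) = M :=
      iSup_mem_finset_eq_of_forall_le (by simpa [evenW] using he) hfp fun w _ => hle w
    have h2 : (⨆ w : {w : α → Bool // w ∈ oddW S}, f w.1) = M - |μ0 k - μ1 k| :=
      iSup_mem_finset_eq_of_forall_le (w := q)
        (Finset.mem_filter.mpr ⟨Finset.mem_univ _, by tauto⟩) hfq
        fun w hw => hle' w (by have := (Finset.mem_filter.mp hw).2; tauto)
    rw [h1, h2, he.neg_one_pow]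
    ring
  · have h1 : (⨆ w : {w : α → Bool // w ∈ oddW S}, f w.1) = M :=
      iSup_mem_finset_eq_of_forall_le
        (Finset.mem_filter.mpr ⟨Finset.mem_univ _, he⟩) hfp fun w _ => hle w
    have h2 : (⨆ w : {w : α → Bool // w ∈ evenW S}, f w.1) = M - |μ0 k - μ1 k| :=
      iSup_mem_finset_eq_of_forall_le (w := q)
        (Finset.mem_filter.mpr ⟨Finset.mem_univ _, by tauto⟩) hfq
        fun w hw => hle' w (by have := (Finset.mem_filter.mp hw).2; tauto)
    rw [h1, h2, (Nat.not_even_iff_odd.mp he).neg_one_pow]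
    ring
end
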